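/- Let A, A_s ∈ ℝ^{N×N}, b ∈ ℝ^N, λ ≠ 0, and ε_s ≥ 0 with ‖A − A_s‖₂ ≤ ε_s. Let x* and x_s* be the unique minimizers of Φ and Φ_s respectively, and assume AᵀA_s + λ²I is invertible with ‖(AᵀA_s + λ²I)⁻¹‖₂ ≤ β. Let L ≥ ‖A_s‖₂², let x̃₀ ∈ ℝ^N, and let (x̃_k) be the FISTA iterates for Φ_s: ỹ₁ = x̃₀, t₁ = 1, x̃_k = (1/(L+λ²))(L ỹ_k − A_sᵀ(A_s ỹ_k − b)), t_{k+1} = (1+√(1+4t_k²))/2, ỹ_{k+1} = x̃_k + ((t_k−1)/t_{k+1})(x̃_k − x̃_{k−1}). Assume ‖x̃_k‖₂ ≤ M for all k ≥ 0. Then for every k ≥ 1: |Φ(x̃_k) − Φ(x*)| ≤ 2L‖x̃₀ − x_s*‖₂²/(k+1)² + c₀ ε_s, where c₀ = (½(‖A‖₂ + ‖A_s‖₂)M + ‖b‖₂)M + ½‖b‖₂(‖A‖₂ β (‖b‖₂ + ‖A‖₂‖x*‖₂ + ‖A_s‖₂‖x_s*‖₂) + ‖x_s*‖₂). -/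

import Mathlib

open Matrix
noncomputable section

/-- Multiplication of a matrix with a vector of `EuclideanSpace ℝ (Fin N)`. -/
def mulVecE {N : ℕ} (A : Matrix (Fin N) (Fin N) ℝ) (x : EuclideanSpace ℝ (Fin N)) :
    EuclideanSpace ℝ (Fin N) :=
  (WithLp.equiv 2 (Fin N → ℝ)).symm (A.mulVec ((WithLp.equiv 2 (Fin N → ℝ)) x))

/-- The operator 2-norm of a matrix, induced by the Euclidean norms. -/
def opNorm {N : ℕ} (A : Matrix (Fin N) (Fin N) ℝ) : ℝ :=
  ‖Matrix.toEuclideanCLM (𝕜 := ℝ) A‖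

section Tikhonov

open ContinuousLinearMap

variable {E : Type*} [NormedAddCommGroup E] [InnerProductSpace ℝ E]

/-- The Tikhonov functional with regularization weight `μ`. -/
def tikhonov (T : E →L[ℝ] E) (b : E) (μ : ℝ) (z : E) : ℝ :=
  1 / 2 * ‖T z - b‖ ^ 2 + μ / 2 * ‖z‖ ^ 2

lemma abs_tikhonov_sub_le (T S : E →L[ℝ] E) (b : E) (μ : ℝ) {ε M : ℝ} {z : E}
    (hTS : ‖T - S‖ ≤ ε) (hz : ‖z‖ ≤ M) :
    |tikhonov T b μ z - tikhonov S b μ z| ≤ (1 / 2 * (‖T‖ + ‖S‖) * M + ‖b‖) * M * ε := by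
  have key : tikhonov T b μ z - tikhonov S b μ z =
      1 / 2 * inner ℝ ((T - S) z) ((T z + S z) - (2 : ℝ) • b) := by
    simp only [tikhonov, ← real_inner_self_eq_norm_sq, _root_.sub_apply, inner_sub_left,
      inner_sub_right, inner_add_right, real_inner_smul_right]
    rw [real_inner_comm (T z) b, real_inner_comm (S z) b, real_inner_comm (S z) (T z)]
    ring
  have hM : 0 ≤ M := (norm_nonneg z).trans hz
  have hε : 0 ≤ ε := (norm_nonneg _).trans hTS
  have hdiff : ‖(T - S) z‖ ≤ ε * M := (T - S).le_of_opNorm_le_of_le hTS hz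
  have hsum : ‖(T z + S z) - (2 : ℝ) • b‖ ≤ ‖T‖ * M + ‖S‖ * M + 2 * ‖b‖ := by
    refine (norm_sub_le _ _).trans (add_le_add ((norm_add_le _ _).trans
      (add_le_add (T.le_opNorm_of_le hz) (S.le_opNorm_of_le hz))) ?_)
    simp [norm_smul]
  have hin := (abs_real_inner_le_norm ((T - S) z) ((T z + S z) - (2 : ℝ) • b)).trans
    (mul_le_mul hdiff hsum (norm_nonneg _) (by positivity))
  rw [key, abs_mul, abs_of_pos (by norm_num : (0 : ℝ) < 1 / 2)]
  linarith

variable [CompleteSpace E]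

lemma tikhonov_sub_eq (T : E →L[ℝ] E) (b : E) (μ : ℝ) (z p : E) :
    tikhonov T b μ z - tikhonov T b μ p =
      inner ℝ (adjoint T (T p - b) + μ • p) (z - p) +
        (1 / 2 * ‖T (z - p)‖ ^ 2 + μ / 2 * ‖z - p‖ ^ 2) := by
  simp only [tikhonov, ← real_inner_self_eq_norm_sq, inner_add_left, adjoint_inner_left,
    real_inner_smul_left, map_sub, inner_sub_left, inner_sub_right]
  rw [real_inner_comm (T z) b, real_inner_comm (T p) b, real_inner_comm (T z) (T p),
    real_inner_comm z p]
  ring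

lemma tikhonov_normal_equation {T : E →L[ℝ] E} {b : E} {μ : ℝ} {p : E}
    (hp : ∀ z, tikhonov T b μ p ≤ tikhonov T b μ z) :
    adjoint T (T p - b) + μ • p = 0 := by
  set g := adjoint T (T p - b) + μ • p with hg
  have h : ∀ s : ℝ, 0 ≤ (1 / 2 * ‖T g‖ ^ 2 + μ / 2 * ‖g‖ ^ 2) * (s * s) + ‖g‖ ^ 2 * s + 0 := by
    intro s
    have h1 := tikhonov_sub_eq T b μ (p + s • g) p
    have h2 := hp (p + s • g)
    rw [← hg, add_sub_cancel_left, real_inner_smul_right, real_inner_self_eq_norm_sq, map_smul,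
      norm_smul, norm_smul, mul_pow, mul_pow, Real.norm_eq_abs, sq_abs] at h1
    linarith
  have hd := discrim_le_zero h
  simp only [discrim, mul_zero, sub_zero] at hd
  have : (‖g‖ ^ 2) ^ 2 = 0 := le_antisymm hd (by positivity)
  simpa using this

lemma tikhonov_eq_of_normal_equation {T : E →L[ℝ] E} {b : E} {μ : ℝ} {p : E}
    (hp : adjoint T (T p - b) + μ • p = 0) :
    tikhonov T b μ p = 1 / 2 * (‖b‖ ^ 2 - inner ℝ b (T p)) := by
  have h := tikhonov_sub_eq T b μ 0 p
  simp only [hp, inner_zero_left, tikhonov, zero_sub, map_zero, map_neg, norm_neg, norm_zero] at h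
  rw [tikhonov]
  have h2 := norm_sub_sq_real (T p) b
  rw [real_inner_comm] at h2
  linarith

lemma tikhonov_minimizer_perturbation {T S R : E →L[ℝ] E} {b x y : E} {μ β ε : ℝ}
    (hx : adjoint T (T x - b) + μ • x = 0) (hy : adjoint S (S y - b) + μ • y = 0)
    (hR : ∀ z, R (adjoint T (S z) + μ • z) = z) (hβ : ‖R‖ ≤ β) (hTS : ‖T - S‖ ≤ ε) :
    ‖x - y‖ ≤ β * (ε * (‖b‖ + ‖T‖ * ‖x‖ + ‖S‖ * ‖y‖)) := by
  have key : adjoint T (S (x - y)) + μ • (x - y) =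
      adjoint (T - S) b - adjoint T ((T - S) x) - adjoint (T - S) (S y) := by
    have hxy := hx.trans hy.symm
    simp only [map_sub, _root_.sub_apply] at hxy ⊢
    rw [← sub_eq_zero] at hxy ⊢
    rw [smul_sub, ← hxy]
    abel
  have had : ‖adjoint (T - S)‖ ≤ ε := by rwa [LinearIsometryEquiv.norm_map]
  have h1 : ‖adjoint (T - S) b‖ ≤ ε * ‖b‖ := le_of_opNorm_le _ had b
  have h2 : ‖adjoint T ((T - S) x)‖ ≤ ‖T‖ * (ε * ‖x‖) :=
    le_of_opNorm_le_of_le _ (LinearIsometryEquiv.norm_map adjoint T).le (le_of_opNorm_le _ hTS x)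
  have h3 : ‖adjoint (T - S) (S y)‖ ≤ ε * (‖S‖ * ‖y‖) :=
    le_of_opNorm_le_of_le _ had (S.le_opNorm y)
  rw [← hR (x - y), key]
  refine le_of_opNorm_le_of_le _ hβ ?_
  linarith [norm_sub_le (adjoint (T - S) b - adjoint T ((T - S) x)) (adjoint (T - S) (S y)),
    norm_sub_le (adjoint (T - S) b) (adjoint T ((T - S) x))]

lemma abs_tikhonov_minimum_sub_le {T S R : E →L[ℝ] E} {b x y : E} {μ β ε : ℝ}
    (hx : adjoint T (T x - b) + μ • x = 0) (hy : adjoint S (S y - b) + μ • y = 0)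
    (hR : ∀ z, R (adjoint T (S z) + μ • z) = z) (hβ : ‖R‖ ≤ β) (hTS : ‖T - S‖ ≤ ε) :
    |tikhonov S b μ y - tikhonov T b μ x| ≤
      1 / 2 * ‖b‖ * (‖T‖ * β * (‖b‖ + ‖T‖ * ‖x‖ + ‖S‖ * ‖y‖) + ‖y‖) * ε := by
  have hxy := tikhonov_minimizer_perturbation hx hy hR hβ hTS
  have key : tikhonov S b μ y - tikhonov T b μ x =
      1 / 2 * inner ℝ b (T (x - y) + (T - S) y) := by
    rw [tikhonov_eq_of_normal_equation hx, tikhonov_eq_of_normal_equation hy]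
    simp only [map_sub, _root_.sub_apply, inner_add_right, inner_sub_right]
    ring
  have h := (norm_add_le (T (x - y)) ((T - S) y)).trans
    (add_le_add (T.le_opNorm_of_le hxy) (le_of_opNorm_le _ hTS y))
  have hin := (abs_real_inner_le_norm b (T (x - y) + (T - S) y)).trans
    (mul_le_mul_of_nonneg_left h (norm_nonneg b))
  rw [key, abs_mul, abs_of_pos (by norm_num : (0 : ℝ) < 1 / 2)]
  linarith

/-- The descent inequality for one proximal gradient step. -/
lemma tikhonov_prox_step {T : E →L[ℝ] E} {b y p : E} {μ L : ℝ} (hμ : 0 ≤ μ)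
    (hL : ‖T‖ ^ 2 ≤ L) (hp : (L + μ) • p = L • y - adjoint T (T y - b)) (z : E) :
    L / 2 * ‖p - y‖ ^ 2 + L * inner ℝ (p - y) (y - z) ≤
      tikhonov T b μ z - tikhonov T b μ p := by
  have hgrad : adjoint T (T p - b) + μ • p = adjoint T (T (p - y)) - L • (p - y) := by
    have hμp : μ • p = L • y - adjoint T (T y - b) - L • p := by
      rw [← hp, add_smul]
      abel
    rw [hμp]
    simp only [map_sub, smul_sub]
    abel
  have hzp : z - p = -(p - y) - (y - z) := by abel
  have hsq : ‖T (p - y)‖ ^ 2 ≤ L * ‖p - y‖ ^ 2 := by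
    calc ‖T (p - y)‖ ^ 2 ≤ (‖T‖ * ‖p - y‖) ^ 2 := by gcongr; exact T.le_opNorm _
      _ = ‖T‖ ^ 2 * ‖p - y‖ ^ 2 := by ring
      _ ≤ L * ‖p - y‖ ^ 2 := by gcongr
  have hT := norm_add_sq_real (T (p - y)) (T (z - p))
  have hin : inner ℝ (p - y) (z - p) = -‖p - y‖ ^ 2 - inner ℝ (p - y) (y - z) := by
    rw [hzp, inner_sub_right, inner_neg_right, real_inner_self_eq_norm_sq]
  rw [tikhonov_sub_eq, hgrad, inner_sub_left (adjoint T _), adjoint_inner_left, real_inner_smul_left, hin]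
  nlinarith [sq_nonneg ‖T (p - y) + T (z - p)‖, mul_nonneg hμ (sq_nonneg ‖z - p‖)]

/-- One step of the FISTA Lyapunov inequality. -/
lemma tikhonov_fista_step {T : E →L[ℝ] E} {b y p : E} {μ L τ : ℝ} (hμ : 0 ≤ μ)
    (hL : ‖T‖ ^ 2 ≤ L) (hp : (L + μ) • p = L • y - adjoint T (T y - b)) (hτ : 1 ≤ τ) (q x : E) :
    2 * τ ^ 2 * (tikhonov T b μ p - tikhonov T b μ x) +
        L * ‖τ • p - (τ - 1) • q - x‖ ^ 2 ≤
      2 * (τ * (τ - 1)) * (tikhonov T b μ q - tikhonov T b μ x) +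
        L * ‖τ • y - (τ - 1) • q - x‖ ^ 2 := by
  have hq := mul_le_mul_of_nonneg_left (tikhonov_prox_step hμ hL hp q)
    (mul_nonneg (by linarith : 0 ≤ τ) (sub_nonneg.2 hτ))
  have hx := mul_le_mul_of_nonneg_left (tikhonov_prox_step hμ hL hp x) (by linarith : 0 ≤ τ)
  have hu : τ • p - (τ - 1) • q - x = τ • (p - y) + (τ • y - (τ - 1) • q - x) := by
    rw [smul_sub]
    abel
  have hw : τ • y - (τ - 1) • q - x = (τ - 1) • (y - q) + (y - x) := by
    module
  rw [hu, norm_add_sq_real, norm_smul, mul_pow, Real.norm_eq_abs, sq_abs, real_inner_smul_left]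
  have hin : inner ℝ (p - y) (τ • y - (τ - 1) • q - x) =
      (τ - 1) * inner ℝ (p - y) (y - q) + inner ℝ (p - y) (y - x) := by
    rw [hw, inner_add_right, real_inner_smul_right]
  rw [hin]
  linarith

lemma half_add_one_le_of_fista_recurrence {t : ℕ → ℝ} (ht1 : t 1 = 1)
    (ht : ∀ k ≥ 1, t (k + 1) = (1 + Real.sqrt (1 + 4 * t k ^ 2)) / 2) :
    ∀ k : ℕ, k ≥ 1 → ((k : ℝ) + 1) / 2 ≤ t k := by
  intro k hk
  induction k, hk using Nat.le_induction with
  | base => norm_num [ht1]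
  | succ k hk ih =>
    have : 2 * t k ≤ Real.sqrt (1 + 4 * t k ^ 2) := Real.le_sqrt_of_sq_le (by linarith)
    rw [ht k hk]
    push_cast
    linarith

theorem tikhonov_fista_rate {T : E →L[ℝ] E} {b : E} {μ L : ℝ} (hμ : 0 ≤ μ)
    (hL : ‖T‖ ^ 2 ≤ L) {x y : ℕ → E} {t : ℕ → ℝ} {xmin : E}
    (hmin : ∀ z, tikhonov T b μ xmin ≤ tikhonov T b μ z)
    (hy1 : y 1 = x 0) (ht1 : t 1 = 1)
    (hx : ∀ k ≥ 1, (L + μ) • x k = L • y k - adjoint T (T (y k) - b))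
    (ht : ∀ k ≥ 1, t (k + 1) = (1 + Real.sqrt (1 + 4 * t k ^ 2)) / 2)
    (hy : ∀ k ≥ 1, y (k + 1) = x k + ((t k - 1) / t (k + 1)) • (x k - x (k - 1))) :
    ∀ k ≥ 1, tikhonov T b μ (x k) - tikhonov T b μ xmin ≤
      2 * L * ‖x 0 - xmin‖ ^ 2 / ((k : ℝ) + 1) ^ 2 := by
  have htk := half_add_one_le_of_fista_recurrence ht1 ht
  have htk_one : ∀ k ≥ 1, 1 ≤ t k := fun k hk => by
    have : (1 : ℝ) ≤ k := by exact_mod_cast hk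
    linarith [htk k hk]
  have hlyap : ∀ k ≥ 1, 2 * t k ^ 2 * (tikhonov T b μ (x k) - tikhonov T b μ xmin) +
      L * ‖t k • x k - (t k - 1) • x (k - 1) - xmin‖ ^ 2 ≤ L * ‖x 0 - xmin‖ ^ 2 := by
    intro k hk
    induction k, hk using Nat.le_induction with
    | base =>
      have h := tikhonov_fista_step hμ hL (hx 1 le_rfl) le_rfl (x 0) xmin
      simpa [hy1, ht1] using h
    | succ k hk ih =>
      have hone := htk_one (k + 1) (by omega)
      have h := tikhonov_fista_step hμ hL (hx (k + 1) (by omega)) hone (x k) xmin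
      have hsq : t (k + 1) * (t (k + 1) - 1) = t k ^ 2 := by
        rw [ht k hk]
        linarith [Real.sq_sqrt (by positivity : 0 ≤ 1 + 4 * t k ^ 2)]
      have hw : t (k + 1) • y (k + 1) - (t (k + 1) - 1) • x k - xmin =
          t k • x k - (t k - 1) • x (k - 1) - xmin := by
        rw [hy k hk, smul_add, smul_smul, mul_div_cancel₀ _ (by linarith : t (k + 1) ≠ 0)]
        module
      rw [hsq, hw] at h
      exact h.trans ih
  intro k hk
  have hv := sub_nonneg.2 (hmin (x k))
  have hL0 : 0 ≤ L := (sq_nonneg _).trans hL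
  rw [le_div_iff₀ (by positivity)]
  have hsq : (((k : ℝ) + 1) / 2) ^ 2 ≤ t k ^ 2 := by
    gcongr
    exact htk k hk
  have h1 := mul_le_mul_of_nonneg_left hsq hv
  have h2 : 0 ≤ L * ‖t k • x k - (t k - 1) • x (k - 1) - xmin‖ ^ 2 := by positivity
  linarith [hlyap k hk]

end Tikhonov

lemma mulVecE_eq_toEuclideanCLM {N : ℕ} (A : Matrix (Fin N) (Fin N) ℝ)
    (x : EuclideanSpace ℝ (Fin N)) : mulVecE A x = toEuclideanCLM (𝕜 := ℝ) A x := rfl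

lemma toEuclideanCLM_transpose {N : ℕ} (A : Matrix (Fin N) (Fin N) ℝ) :
    toEuclideanCLM (𝕜 := ℝ) Aᵀ = ContinuousLinearMap.adjoint (toEuclideanCLM (𝕜 := ℝ) A) := by
  rw [← conjTranspose_eq_transpose_of_trivial, ← star_eq_conjTranspose, map_star,
    ContinuousLinearMap.star_eq_adjoint]

/-- Total error of sFISTA: if `‖A − A_s‖₂ ≤ ε_s`, `x*` and `x_s*` are the minimizers of
`Φ` and `Φ_s`, `AᵀA_s + λ²I` is invertible with `‖(AᵀA_s + λ²I)⁻¹‖₂ ≤ β`, `L ≥ ‖A_s‖₂²`,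
the sequence `x̃_k` is generated by FISTA applied to `Φ_s`, and `‖x̃_k‖ ≤ M` for all `k`,
then for every `k ≥ 1`:
`|Φ(x̃_k) − Φ(x*)| ≤ 2L‖x̃₀ − x_s*‖²/(k+1)² + c₀ ε_s` with the explicit constant `c₀`. -/
theorem sFISTA_total_error {N : ℕ}
    (A As : Matrix (Fin N) (Fin N) ℝ) (b : EuclideanSpace ℝ (Fin N))
    (lam epss beta L M : ℝ) (hlam : lam ≠ 0) (hepss : 0 ≤ epss)
    (hAAs : opNorm (A - As) ≤ epss)
    (Φ Φs : EuclideanSpace ℝ (Fin N) → ℝ)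
    (hΦ : ∀ z, Φ z = 1 / 2 * ‖mulVecE A z - b‖ ^ 2 + lam ^ 2 / 2 * ‖z‖ ^ 2)
    (hΦs : ∀ z, Φs z = 1 / 2 * ‖mulVecE As z - b‖ ^ 2 + lam ^ 2 / 2 * ‖z‖ ^ 2)
    (xstar xsstar : EuclideanSpace ℝ (Fin N))
    (hxstar : ∀ z, Φ xstar ≤ Φ z) (hxsstar : ∀ z, Φs xsstar ≤ Φs z)
    (hinv : IsUnit (Aᵀ * As + lam ^ 2 • (1 : Matrix (Fin N) (Fin N) ℝ)))
    (hbeta : opNorm (Aᵀ * As + lam ^ 2 • (1 : Matrix (Fin N) (Fin N) ℝ))⁻¹ ≤ beta)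
    (hL : opNorm As ^ 2 ≤ L)
    (xt yt : ℕ → EuclideanSpace ℝ (Fin N)) (t : ℕ → ℝ)
    (hy1 : yt 1 = xt 0) (ht1 : t 1 = 1)
    (hx : ∀ k ≥ 1, xt k = (1 / (L + lam ^ 2)) •
      (L • yt k - mulVecE Asᵀ (mulVecE As (yt k) - b)))
    (ht : ∀ k ≥ 1, t (k + 1) = (1 + Real.sqrt (1 + 4 * t k ^ 2)) / 2)
    (hy : ∀ k ≥ 1, yt (k + 1) = xt k + ((t k - 1) / t (k + 1)) • (xt k - xt (k - 1)))
    (hM : ∀ k, ‖xt k‖ ≤ M) :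
    ∀ k ≥ 1, |Φ (xt k) - Φ xstar| ≤
      2 * L * ‖xt 0 - xsstar‖ ^ 2 / ((k : ℝ) + 1) ^ 2 +
        ((1 / 2 * (opNorm A + opNorm As) * M + ‖b‖) * M +
          1 / 2 * ‖b‖ * (opNorm A * beta *
            (‖b‖ + opNorm A * ‖xstar‖ + opNorm As * ‖xsstar‖) + ‖xsstar‖)) * epss := by
  have hlam2 : 0 < lam ^ 2 := by positivity
  have hL0 : 0 ≤ L := (sq_nonneg _).trans hL
  set T := toEuclideanCLM (𝕜 := ℝ) A with hT
  set S := toEuclideanCLM (𝕜 := ℝ) As with hS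
  set R := toEuclideanCLM (𝕜 := ℝ)
    (Aᵀ * As + lam ^ 2 • (1 : Matrix (Fin N) (Fin N) ℝ))⁻¹
  obtain rfl : Φ = tikhonov T b (lam ^ 2) := funext hΦ
  obtain rfl : Φs = tikhonov S b (lam ^ 2) := funext hΦs
  have hTS : ‖T - S‖ ≤ epss := by
    rw [hT, hS, ← map_sub]
    exact hAAs
  have hR : ∀ z, R (ContinuousLinearMap.adjoint T (S z) + lam ^ 2 • z) = z := by
    intro z
    have hz : ContinuousLinearMap.adjoint T (S z) + lam ^ 2 • z =
        toEuclideanCLM (𝕜 := ℝ) (Aᵀ * As + lam ^ 2 • (1 : Matrix (Fin N) (Fin N) ℝ)) z := by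
      rw [map_add, map_mul, map_smul, map_one, toEuclideanCLM_transpose]
      rfl
    have hinv_mul := congrArg (toEuclideanCLM (𝕜 := ℝ))
      (nonsing_inv_mul _ ((isUnit_iff_isUnit_det _).1 hinv))
    rw [map_mul, map_one] at hinv_mul
    rw [hz]
    exact congrArg (fun f : EuclideanSpace ℝ (Fin N) →L[ℝ] EuclideanSpace ℝ (Fin N) => f z)
      hinv_mul
  have hstep : ∀ k ≥ 1, (L + lam ^ 2) • xt k =
      L • yt k - ContinuousLinearMap.adjoint S (S (yt k) - b) := by
    intro k hk
    rw [hx k hk, smul_smul, mul_one_div_cancel (by positivity), one_smul,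
      mulVecE_eq_toEuclideanCLM, toEuclideanCLM_transpose]
    rfl
  intro k hk
  have hperturb := abs_tikhonov_sub_le T S b (lam ^ 2) hTS (hM k)
  have hmin := abs_tikhonov_minimum_sub_le (tikhonov_normal_equation hxstar)
    (tikhonov_normal_equation hxsstar) hR hbeta hTS
  have hrate := tikhonov_fista_rate hlam2.le hL hxsstar hy1 ht1 hstep ht hy k hk
  have hpos := hxsstar (xt k)
  change _ ≤ _ + ((1 / 2 * (‖T‖ + ‖S‖) * M + ‖b‖) * M + 1 / 2 * ‖b‖ * (‖T‖ * beta *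
    (‖b‖ + ‖T‖ * ‖xstar‖ + ‖S‖ * ‖xsstar‖) + ‖xsstar‖)) * epss
  rw [abs_le] at hperturb hmin ⊢
  constructor <;> linarith
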